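/- arXiv:math/0604498 — 2 statements merged into one kernel-verified Lean document; each statement's English description precedes it below -/
import Mathlib

section
/- Every highest weight vector in U(sl2) for the adjoint action (i.e., every element killed by ad(e)) belongs to the subalgebra generated by e and the center Z(U(sl2)). In particular, every ad(e)-invariant element of adjoint weight 0 in U(sl2) is central. -/
noncomputable section

open Polynomial

/-- Free algebra on generators e, h, f. -/
abbrev F3 : Type := FreeAlgebra ℂ (Fin 3)

def se : F3 := FreeAlgebra.ι ℂ 0
def sh : F3 := FreeAlgebra.ι ℂ 1
def sf : F3 := FreeAlgebra.ι ℂ 2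

/-- Defining relations of U(sl₂): [h,e]=2e, [h,f]=−2f, [e,f]=h. -/
inductive SRel : F3 → F3 → Prop
  | he : SRel (sh * se) (se * sh + 2 * se)
  | hf : SRel (sh * sf) (sf * sh - 2 * sf)
  | ef : SRel (se * sf) (sf * se + sh)

/-- The universal enveloping algebra U(sl₂). -/
abbrev Usl2 : Type := RingQuot SRel

def ρ : F3 →ₐ[ℂ] Usl2 := RingQuot.mkAlgHom ℂ SRel

namespace HW

abbrev R : Type := ℂ[X][X]

abbrev e : Usl2 := ρ se
abbrev h : Usl2 := ρ sh
abbrev f : Usl2 := ρ sf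

lemma rho_two : ρ 2 = 2 := map_ofNat ρ 2

lemma rel_he : h * e = e * h + 2 * e := by
  have := RingQuot.mkAlgHom_rel ℂ SRel.he
  change ρ _ = ρ _ at this
  rwa [map_mul, map_add, map_mul, map_mul, rho_two] at this
lemma rel_hf : h * f = f * h - 2 * f := by
  have := RingQuot.mkAlgHom_rel ℂ SRel.hf
  change ρ _ = ρ _ at this
  rwa [map_mul, map_sub, map_mul, map_mul, rho_two] at this
lemma rel_ef : e * f = f * e + h := by
  have := RingQuot.mkAlgHom_rel ℂ SRel.ef
  simpa [ρ, h, e, f] using this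

lemma U_ind {P : Usl2 → Prop} (hc : ∀ c : ℂ, P (algebraMap ℂ Usl2 c))
    (ha : ∀ a b, P a → P b → P (a + b)) (hm : ∀ a b, P a → P b → P (a * b))
    (he : P e) (hh : P h) (hf : P f) (u : Usl2) : P u := by
  obtain ⟨w, rfl⟩ := RingQuot.mkAlgHom_surjective ℂ SRel u
  change P (ρ w)
  induction w using FreeAlgebra.induction with
  | grade0 c => simpa using hc c
  | grade1 i => fin_cases i <;> assumption
  | mul a b h1 h2 => rw [map_mul]; exact hm _ _ h1 h2
  | add a b h1 h2 => rw [map_add]; exact ha _ _ h1 h2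

lemma g_e {A : Type*} [Ring A] (e h f : A) (rel_he : h * e = e * h + 2 * e) (rel_ef : e * f = f * e + h) : (h * h + 4 * (e * f) - 2 * h) * e = e * (h * h + 4 * (e * f) - 2 * h) := by
  have h1 := rel_he
  have h2 := rel_ef
  have h2' : f * e = e * f - h := by rw [h2]; abel
  have a1 : h * h * e = e * h * h + 4 * (e * h) + 4 * e := by
    rw [mul_assoc, h1, mul_add, ← mul_assoc, h1]
    have : h * (2 * e) = 2 * (h * e) := by noncomm_ring
    rw [this, h1]; noncomm_ring
  have a2 : e * f * e = e * e * f - e * h := by rw [mul_assoc, h2']; noncomm_ring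
  have : (h * h + 4 * (e * f) - 2 * h) * e = h * h * e + 4 * (e * f * e) - 2 * (h * e) := by noncomm_ring
  rw [this, a1, a2, h1]; noncomm_ring

lemma g_h {A : Type*} [Ring A] (e h f : A) (rel_he : h * e = e * h + 2 * e) (rel_hf : h * f = f * h - 2 * f) : (h * h + 4 * (e * f) - 2 * h) * h = h * (h * h + 4 * (e * f) - 2 * h) := by
  have a1 : h * (e * f) = e * f * h := by
    rw [← mul_assoc, rel_he, add_mul, mul_assoc, rel_hf]; noncomm_ring
  have : h * (h * h + 4 * (e * f) - 2 * h) = h * h * h + 4 * (h * (e * f)) - 2 * (h * h) := by noncomm_ring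
  rw [this, a1]; noncomm_ring

lemma g_f {A : Type*} [Ring A] (e h f : A) (rel_hf : h * f = f * h - 2 * f) (rel_ef : e * f = f * e + h) : (h * h + 4 * (e * f) - 2 * h) * f = f * (h * h + 4 * (e * f) - 2 * h) := by
  have h1 := rel_hf
  have a1 : h * h * f = f * h * h - 4 * (f * h) + 4 * f := by
    rw [mul_assoc, h1, mul_sub, ← mul_assoc, h1]
    have : h * (2 * f) = 2 * (h * f) := by noncomm_ring
    rw [this, h1]; noncomm_ring
  have a2 : e * f * f = f * e * f + h * f := by rw [rel_ef]; noncomm_ring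
  have : (h * h + 4 * (e * f) - 2 * h) * f = h * h * f + 4 * (e * f * f) - 2 * (h * f) := by noncomm_ring
  rw [this, a1, a2, h1]; noncomm_ring

lemma g_ef {A : Type*} [Ring A] (e h f : A) (n : ℤ) (hn : n = 0) :
    (h * h + 4 * (e * f) - 2 * h) - (h + (2 * n : ℤ)) * ((h + (2 * n : ℤ)) - 2) = 4 * (e * f) := by
  subst hn; push_cast; noncomm_ring

lemma g_fe {A : Type*} [Ring A] (e h f : A) (n : ℤ) (hn : n = 1) (rel_ef : e * f = f * e + h) :
    (h * h + 4 * (e * f) - 2 * h) - (h + (2 * n : ℤ)) * ((h + (2 * n : ℤ)) - 2) = 4 * (f * e) := by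
  subst hn; rw [rel_ef]; push_cast; noncomm_ring

lemma g_Le {A : Type*} [Ring A] (e h : A) (n : ℤ) (rel_he : h * e = e * h + 2 * e) :
    (h + (2 * n : ℤ)) * e = e * (h + (2 * (n + 1) : ℤ)) := by
  rw [add_mul, rel_he, Int.cast_comm]; push_cast; noncomm_ring

lemma g_Lf {A : Type*} [Ring A] (f h : A) (n : ℤ) (rel_hf : h * f = f * h - 2 * f) :
    (h + (2 * n : ℤ)) * f = f * (h + (2 * (n - 1) : ℤ)) := by
  rw [add_mul, rel_hf, Int.cast_comm]; push_cast; noncomm_ring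

lemma g_Q {A : Type*} [Ring A] (c D l m a : A) (hc : c * a = a * c) (hD : D * a = a * D)
    (hL : l * a = a * m) : c * (D - l * (l - 2)) * a = a * (c * (D - m * (m - 2))) := by
  have h2 : l * (l * a) = a * m * m := by rw [hL, ← mul_assoc, hL]
  have : (D - l * (l - 2)) * a = a * (D - m * (m - 2)) := by
    calc (D - l * (l - 2)) * a = D * a - l * (l * a) + 2 * (l * a) := by noncomm_ring
      _ = _ := by rw [h2, hL, hD]; noncomm_ring
  rw [mul_assoc, this, ← mul_assoc, hc, mul_assoc]

def Δ : Usl2 := h * h + 4 * (e * f) - 2 * h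

lemma Δ_e : Δ * e = e * Δ := g_e e h f rel_he rel_ef
lemma Δ_h : Δ * h = h * Δ := g_h e h f rel_he rel_hf
lemma Δ_f : Δ * f = f * Δ := g_f e h f rel_hf rel_ef

lemma Δ_comm (u : Usl2) : Commute Δ u := by
  induction u using U_ind with
  | hc c => exact (Algebra.commutes c Δ).symm
  | ha a b h1 h2 => exact h1.add_right h2
  | hm a b h1 h2 => exact h1.mul_right h2
  | he => exact Δ_e
  | hh => exact Δ_h
  | hf => exact Δ_f

lemma aevalΔ_comm (a : ℂ[X]) (u : Usl2) : Commute (aeval Δ a) u := by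
  induction a using Polynomial.induction_on' with
  | add p q h1 h2 => rw [map_add]; exact h1.add_left h2
  | monomial n c =>
    rw [aeval_monomial]
    exact Commute.mul_left (Algebra.commutes c u) ((Δ_comm u).pow_left n)

def ev : R →+* Usl2 :=
  eval₂RingHom' (aeval (R := ℂ) Δ : ℂ[X] →ₐ[ℂ] Usl2).toRingHom h (fun a => aevalΔ_comm a h)

lemma ev_C (a : ℂ[X]) : ev (C a) = aeval Δ a := by
  simp [ev, eval₂RingHom']
lemma ev_X : ev X = h := by
  simp [ev, eval₂RingHom']

lemma ev_CC (c : ℂ) : ev (C (C c)) = algebraMap ℂ _ c := by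
  rw [ev_C]; simp

def L (n : ℤ) : R := X + ((2 * n : ℤ) : R)
def Q (n : ℤ) : R := C (C (1/4)) * (C X - L n * (L n - 2))

lemma four_inv : algebraMap ℂ Usl2 (1/4) * 4 = 1 := by
  have : (4 : Usl2) = algebraMap ℂ Usl2 4 := (map_ofNat (algebraMap ℂ Usl2) 4).symm
  rw [this, ← map_mul]; norm_num

lemma ev_L (n : ℤ) : ev (L n) = h + (2 * n : ℤ) := by
  simp only [L, map_add, ev_X, map_intCast]

lemma ev_Q (n : ℤ) : ev (Q n) = algebraMap ℂ _ (1/4) * (Δ - ev (L n) * (ev (L n) - 2)) := by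
  rw [Q, map_mul, ev_CC, map_sub, map_mul, map_sub, ev_C, aeval_X,
    show ev 2 = 2 from map_ofNat ev 2]

lemma ef_eq : e * f = ev (Q 0) := by
  rw [ev_Q, ev_L, Δ, g_ef e h f 0 rfl, ← mul_assoc, four_inv, one_mul]

lemma fe_eq : f * e = ev (Q 1) := by
  rw [ev_Q, ev_L, Δ, g_fe e h f 1 rfl rel_ef, ← mul_assoc, four_inv, one_mul]

lemma L_e (n : ℤ) : ev (L n) * e = e * ev (L (n+1)) := by
  rw [ev_L, ev_L]; exact g_Le e h n rel_he

lemma L_f (n : ℤ) : ev (L n) * f = f * ev (L (n-1)) := by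
  rw [ev_L, ev_L]; exact g_Lf f h n rel_hf

lemma Q_of (n m : ℤ) (a : Usl2) (hL : ev (L n) * a = a * ev (L m)) :
    ev (Q n) * a = a * ev (Q m) := by
  rw [ev_Q, ev_Q]
  exact g_Q _ _ _ _ _ (Algebra.commutes _ _) (Δ_comm a) hL

lemma L_epow (n : ℤ) (k : ℕ) : ev (L n) * e ^ k = e ^ k * ev (L (n+k)) := by
  induction k with
  | zero => simp
  | succ k ih => rw [pow_succ, ← mul_assoc, ih, mul_assoc, L_e, ← mul_assoc]; push_cast; rw [add_assoc]

lemma L_fpow (n : ℤ) (k : ℕ) : ev (L n) * f ^ k = f ^ k * ev (L (n-k)) := by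
  induction k with
  | zero => simp
  | succ k ih => rw [pow_succ, ← mul_assoc, ih, mul_assoc, L_f, ← mul_assoc]; push_cast; rw [sub_sub]

def x : ℤ → Usl2
  | Int.ofNat k => e ^ k
  | Int.negSucc k => f ^ (k+1)

lemma h_x (n : ℤ) : h * x n = x n * ev (L n) := by
  have h0 : h = ev (L 0) := by rw [ev_L]; simp
  rcases n with k | k
  · rw [h0]; simp only [x]; rw [L_epow]; simp
  · rw [h0]; simp only [x]; rw [L_fpow]; simp [Int.negSucc_eq]

lemma e_x (n : ℤ) : ∃ r, e * x n = x (n+1) * ev r := by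
  rcases n with k | k
  · exact ⟨1, by simp only [x, map_one, mul_one, ← pow_succ']; rfl⟩
  · refine ⟨Q (0 - k), ?_⟩
    have : x (Int.negSucc k + 1) = f ^ k := by
      rcases k with _ | k
      · simp [x]
      · rfl
    rw [this, ← Q_of _ _ _ (L_fpow 0 k), ← ef_eq]; simp only [x]; rw [pow_succ', mul_assoc]

lemma f_x (n : ℤ) : ∃ r, f * x n = x (n-1) * ev r := by
  rcases n with (_ | k) | k
  · exact ⟨1, by
      rw [map_one, mul_one]
      change f * e ^ 0 = f ^ (0 + 1)
      simp⟩
  · refine ⟨Q (1 + k), ?_⟩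
    have : x (Int.ofNat (k+1) - 1) = e ^ k := by
      have : (Int.ofNat (k+1) - 1) = Int.ofNat k := by simp
      rw [this]; rfl
    rw [this, ← Q_of _ _ _ (L_epow 1 k), ← fe_eq]; simp only [x]; rw [pow_succ', mul_assoc]
  · refine ⟨1, ?_⟩
    have : Int.negSucc k - 1 = Int.negSucc (k+1) := by omega
    rw [this]; simp only [x, map_one, mul_one]; rw [pow_succ' _ (k+1)]

def Ψ : (ℤ →₀ R) →+ Usl2 :=
  Finsupp.liftAddHom (fun n => (AddMonoidHom.mulLeft (x n)).comp ev.toAddMonoidHom)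

lemma Ψ_single (n : ℤ) (p : R) : Ψ (Finsupp.single n p) = x n * ev p := by
  simp [Ψ]

lemma Ψ_apply (v : ℤ →₀ R) : Ψ v = ∑ n ∈ v.support, x n * ev (v n) := by
  simp [Ψ, Finsupp.sum]

lemma Ψ_mul (a : Usl2) (H : ∀ n, ∃ m r, a * x n = x m * ev r) (v : ℤ →₀ R) :
    ∃ w, a * Ψ v = Ψ w := by
  induction v using Finsupp.induction_linear with
  | zero => exact ⟨0, by simp⟩
  | add v w h1 h2 =>
    obtain ⟨v', h1⟩ := h1
    obtain ⟨w', h2⟩ := h2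
    exact ⟨v' + w', by rw [map_add, map_add, mul_add, h1, h2]⟩
  | single n p =>
    obtain ⟨m, r, hr⟩ := H n
    exact ⟨Finsupp.single m (r * p), by
      rw [Ψ_single, Ψ_single, ← mul_assoc, hr, map_mul, mul_assoc]⟩

lemma Ψ_mul' (u : Usl2) : ∀ v, ∃ w, u * Ψ v = Ψ w := by
  induction u using U_ind with
  | hc c => exact Ψ_mul _ fun n => ⟨n, C (C c), by rw [ev_CC, Algebra.commutes]⟩
  | ha a b h1 h2 =>
    intro v
    obtain ⟨v', h1⟩ := h1 v
    obtain ⟨w', h2⟩ := h2 v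
    exact ⟨v' + w', by rw [map_add, add_mul, h1, h2]⟩
  | hm a b h1 h2 =>
    intro v
    obtain ⟨v', h2⟩ := h2 v
    obtain ⟨w', h1⟩ := h1 v'
    exact ⟨w', by rw [mul_assoc, h2, h1]⟩
  | he => exact Ψ_mul _ fun n => ⟨_, e_x n⟩
  | hh => exact Ψ_mul _ fun n => ⟨_, _, h_x n⟩
  | hf => exact Ψ_mul _ fun n => ⟨_, f_x n⟩

lemma Ψ_surj (u : Usl2) : ∃ v, u = Ψ v := by
  obtain ⟨w, hw⟩ := Ψ_mul' u (Finsupp.single 0 1)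
  refine ⟨w, ?_⟩
  rw [← hw, Ψ_single]
  simp [x, show (0 : ℤ) = Int.ofNat 0 from rfl]

/-! The representation -/

abbrev M : Type := ℤ → R

def oE : Module.End R M where
  toFun v n := v (n-1)
  map_add' _ _ := rfl
  map_smul' _ _ := rfl
def oH : Module.End R M where
  toFun v n := L n * v n
  map_add' _ _ := by ext1 n; simp [mul_add]
  map_smul' _ _ := by ext1 n; simp [mul_left_comm]
def oF : Module.End R M where
  toFun v n := Q (n+1) * v (n+1)
  map_add' _ _ := by ext1 n; simp [mul_add]
  map_smul' _ _ := by ext1 n; simp [mul_left_comm]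

lemma four_inv' : (C (C (1/4)) : R) * 4 = 1 := by
  have : (4 : R) = C (C 4) := (map_ofNat (C.comp C : ℂ →+* R) 4).symm
  rw [this, ← map_mul, ← map_mul]; norm_num

lemma L_succ (n : ℤ) : L (n+1) = L n + 2 := by
  simp only [L]; push_cast; ring

lemma Q_four (n : ℤ) : 4 * Q n = C X - L n * (L n - 2) := by
  rw [Q]; linear_combination (C X - L n * (L n - 2)) * four_inv'

lemma Q_succ (n : ℤ) : Q n = Q (n+1) + L n := by
  rw [Q, Q, L_succ]; linear_combination (L n) * four_inv'

def φ0 : F3 →ₐ[ℂ] Module.End R M := FreeAlgebra.lift ℂ ![oE, oH, oF]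
lemma φ0_e : φ0 se = oE := by simp [φ0, se]
lemma φ0_h : φ0 sh = oH := by simp [φ0, sh]
lemma φ0_f : φ0 sf = oF := by simp [φ0, sf]

def φ : Usl2 →ₐ[ℂ] Module.End R M := RingQuot.liftAlgHom ℂ ⟨φ0, by
  intro a b hab
  cases hab with
  | he =>
    simp only [map_mul, map_add, φ0_e, φ0_h, map_ofNat]
    refine LinearMap.ext fun v => funext fun n => ?_
    have := L_succ (n-1)
    rw [sub_add_cancel] at this
    simp [oE, oH, this, two_mul, add_mul]
  | hf =>
    simp only [map_mul, map_sub, φ0_f, φ0_h, map_ofNat]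
    refine LinearMap.ext fun v => funext fun n => ?_
    simp [oF, oH, L_succ, two_mul]
    ring
  | ef =>
    simp only [map_mul, map_add, φ0_f, φ0_h, φ0_e]
    refine LinearMap.ext fun v => funext fun n => ?_
    simp [oF, oH, oE]
    linear_combination v n * Q_succ n⟩

lemma φ_e : φ e = oE := by rw [← φ0_e]; simp [φ, e, ρ]
lemma φ_h : φ h = oH := by rw [← φ0_h]; simp [φ, h, ρ]
lemma φ_f : φ f = oF := by rw [← φ0_f]; simp [φ, f, ρ]

lemma φ_Δ (v : M) : φ Δ v = (C X : R) • v := by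
  unfold Δ
  simp only [map_sub, map_add, map_mul, φ_e, φ_h, φ_f, map_ofNat]
  funext n
  have : ((4 : Module.End R M) * (oE * oF)) v n = 4 * (oE (oF v) n) := by
    simp [Module.End.mul_apply]
  simp only [LinearMap.sub_apply, LinearMap.add_apply, Pi.sub_apply, Pi.add_apply, this]
  simp [oE, oF, oH, two_mul]
  linear_combination v n * Q_four n

def δ (n : ℤ) (p : R) : M := Pi.single n p

lemma φ_aeval (a : ℂ[X]) (v : M) : φ (aeval Δ a) v = (C a : R) • v := by
  induction a using Polynomial.induction_on generalizing v with
  | C c =>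
    rw [aeval_C, AlgHom.commutes]; 
    funext n
    simp [Module.algebraMap_end_apply, Algebra.smul_def]
  | add p q h1 h2 => simp only [map_add, LinearMap.add_apply, h1, h2, add_smul]
  | monomial n c ih =>
    rw [pow_succ, ← mul_assoc, map_mul, map_mul, Module.End.mul_apply, aeval_X, φ_Δ, ih, smul_smul, ← map_mul C]

lemma oH_δ (p : R) : oH (δ 0 p) = δ 0 (X * p) := by
  funext n
  by_cases hn : n = 0
  · subst hn; simp [oH, δ, L]
  · simp [oH, δ, hn]

lemma oE_δ (n : ℤ) (p : R) : oE (δ n p) = δ (n+1) p := by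
  funext m
  simp [oE, δ, Pi.single_apply, sub_eq_iff_eq_add]

lemma oF_δ (n : ℤ) (p : R) : oF (δ n p) = δ (n-1) (Q n * p) := by
  funext m
  by_cases hn : m = n - 1
  · subst hn; simp [oF, δ]
  · have : m + 1 ≠ n := by omega
    simp [oF, δ, hn, this]

lemma smul_δ (n : ℤ) (p q : R) : p • δ n q = δ n (p * q) := by
  funext m
  by_cases hn : m = n
  · subst hn; simp [δ]
  · simp [δ, hn]

lemma φ_ev (p q : R) : φ (ev p) (δ 0 q) = δ 0 (p * q) := by
  induction p using Polynomial.induction_on generalizing q with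
  | C c => rw [ev_C, φ_aeval, smul_δ]
  | add p p' h1 h2 =>
    simp only [map_add, LinearMap.add_apply, h1, h2, add_mul]; simp only [δ, Pi.single_add]
  | monomial n c ih =>
    rw [pow_succ, ← mul_assoc, map_mul, map_mul, Module.End.mul_apply, ev_X, φ_h, oH_δ, ih, mul_assoc _ X]

lemma Q_deg (n : ℤ) : (Q n).natDegree = 2 := by
  have : Q n = C (C (1/4)) * (C X - (X + C ((2 * n : ℤ) : ℂ[X])) * (X + C ((2 * n - 2 : ℤ) : ℂ[X]))) := by
    simp only [Q, L]
    congr 2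
    have h2 : (C 2 : R) = 2 := map_ofNat C 2
    simp [h2]
    left; ring
  rw [this, natDegree_C_mul (by simp)]
  compute_degree!

lemma Q_ne (n : ℤ) : Q n ≠ 0 := by
  intro hh; have := Q_deg n; rw [hh] at this; simp at this

lemma φ_x (n : ℤ) : ∃ c : R, c ≠ 0 ∧ (0 ≤ n → c = 1) ∧ (n < 0 → 0 < c.natDegree) ∧
    ∀ p, φ (x n) (δ 0 p) = δ n (c * p) := by
  rcases n with k | k
  · refine ⟨1, one_ne_zero, fun _ => rfl, fun h => absurd h (by simp), fun p => ?_⟩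
    simp only [x, one_mul]
    induction k with
    | zero => simp
    | succ k ih => rw [pow_succ', map_mul, Module.End.mul_apply, ih, φ_e, oE_δ]; rfl
  · suffices ∃ c : R, c ≠ 0 ∧ 0 < c.natDegree ∧ ∀ p, φ (x (Int.negSucc k)) (δ 0 p) = δ (Int.negSucc k) (c * p) by
      obtain ⟨c, h1, h2, h3⟩ := this
      exact ⟨c, h1, fun h => absurd h (by simp), fun _ => h2, h3⟩
    induction k with
    | zero => 
      refine ⟨Q 0, Q_ne 0, by simp [Q_deg], fun p => ?_⟩
      simp only [x, zero_add, pow_one, φ_f, oF_δ]; rfl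
    | succ k ih =>
      obtain ⟨c, h1, h2, h3⟩ := ih
      refine ⟨Q (Int.negSucc k) * c, mul_ne_zero (Q_ne _) h1, ?_, fun p => ?_⟩
      · rw [natDegree_mul (Q_ne _) h1]; omega
      · simp only [x] at h3 ⊢
        rw [pow_succ', map_mul, Module.End.mul_apply, h3, φ_f, oF_δ, mul_assoc]; rfl

lemma φ_Ψ (v : ℤ →₀ R) (n : ℤ) : φ (Ψ v) (δ 0 1) n = (φ_x n).choose * v n := by
  induction v using Finsupp.induction_linear with
  | zero => simp
  | add v w h1 h2 => simp [h1, h2, mul_add]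
  | single m p =>
    rw [Ψ_single, map_mul, Module.End.mul_apply, φ_ev, (φ_x m).choose_spec.2.2.2, mul_one]
    by_cases hn : n = m
    · subst hn; simp [δ]
    · have : m ≠ n := fun h => hn h.symm
      simp [δ, hn, this]

def T : M →ₗ[ℂ] M where
  toFun v n := (v (n-1)).comp (X + 2)
  map_add' _ _ := by funext n; simp
  map_smul' c v := by funext n; simp [smul_comp]

lemma L_comp (n : ℤ) : (L n).comp (X + 2) = L (n+1) := by
  rw [L_succ]; simp [L]; ring

lemma Q_comp (n : ℤ) : (Q n).comp (X + 2) = Q (n+1) := by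
  rw [Q, Q, mul_comp, sub_comp, mul_comp, sub_comp, L_comp]; simp

lemma φ_T (u : Usl2) : ∀ v, φ u (T v) = T (φ u v) := by
  induction u using U_ind with
  | hc c => intro v; rw [AlgHom.commutes]; simp [Module.algebraMap_end_apply]
  | ha a b h1 h2 => intro v; simp [h1, h2]
  | hm a b h1 h2 => intro v; simp [h1, h2]
  | he => intro v; rw [φ_e]; rfl
  | hh => intro v; rw [φ_h]; funext n; simp [oH, T, L_comp]
  | hf => intro v; rw [φ_f]; funext n; simp [oF, T, Q_comp]

lemma periodic (p : R) (hp : p.comp (X + 2) = p) : p = C (p.eval 0) := by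
  have key : ∀ k : ℕ, p.eval ((2 * k : ℕ) : ℂ[X]) = p.eval 0 := by
    intro k
    induction k with
    | zero => simp
    | succ k ih =>
      rw [← ih]
      conv_rhs => rw [← hp]
      rw [eval_comp]; simp; ring_nf
  refine eq_of_infinite_eval_eq _ _ (Set.Infinite.mono ?_ (Set.infinite_range_of_injective
    (f := fun k : ℕ => ((2 * k : ℕ) : ℂ[X])) ?_))
  · rintro _ ⟨k, rfl⟩
    simpa using key k
  · intro a b hab
    have := Nat.cast_injective (R := ℂ[X]) hab
    omega

lemma main (u : Usl2) (hu : e * u = u * e) (v : ℤ →₀ R) (hv : u = Ψ v) (n : ℤ) :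
    (n < 0 → v n = 0) ∧ (0 ≤ n → ∃ a, v n = C a) := by
  have h1 : oE (φ u (δ 0 1)) = T (φ u (δ 0 1)) := by
    have hT : T (δ 0 1) = oE (δ 0 1) := by
      rw [oE_δ]
      funext m
      by_cases hm : m = 1
      · subst hm; simp [T, δ]
      · have : m - 1 ≠ 0 := by omega
        simp [T, δ, hm, this]
    rw [← φ_T, hT, ← φ_e, ← Module.End.mul_apply, ← Module.End.mul_apply, ← map_mul, ← map_mul, hu]
  have h2 := congrFun h1 (n+1)
  simp only [oE, T, LinearMap.coe_mk, AddHom.coe_mk, add_sub_cancel_right] at h2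
  have h3 := periodic _ h2.symm
  rw [hv, φ_Ψ] at h3
  obtain ⟨c0, c1, c2, -⟩ := (φ_x n).choose_spec
  constructor
  · intro hn
    by_contra hne
    have := congrArg natDegree h3
    rw [natDegree_mul c0 hne, natDegree_C] at this
    have := c2 hn
    omega
  · intro hn
    rw [c1 hn, one_mul] at h3
    exact ⟨_, h3⟩

lemma main2 (u : Usl2) (hu : h * u = u * h) (v : ℤ →₀ R) (hv : u = Ψ v) (n : ℤ) (hn : n ≠ 0) :
    v n = 0 := by
  have h1 : oH (φ u (δ 0 1)) = (X : R) • (φ u (δ 0 1)) := by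
    rw [← map_smul, smul_δ, ← oH_δ, ← φ_h, ← Module.End.mul_apply, ← Module.End.mul_apply,
      ← map_mul, ← map_mul, hu]
  have h2 := congrFun h1 n
  rw [hv] at h2
  simp only [oH, LinearMap.coe_mk, AddHom.coe_mk, Pi.smul_apply, φ_Ψ, smul_eq_mul, L] at h2
  have h3 : ((2 * n : ℤ) : R) * ((φ_x n).choose * v n) = 0 := by linear_combination h2
  have h4 : ((2 * n : ℤ) : R) ≠ 0 := by
    rw [Int.cast_ne_zero]; omega
  exact ((mul_eq_zero.1 ((mul_eq_zero.1 h3).resolve_left h4))).resolve_left (φ_x n).choose_spec.1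

lemma aeval_center (a : ℂ[X]) : aeval Δ a ∈ Subalgebra.center ℂ Usl2 := by
  rw [Subalgebra.mem_center_iff]
  intro b
  exact (aevalΔ_comm a b).symm

end HW

theorem highest_weight_vectors_in_adjoin_e_center :
    (∀ u : Usl2, ρ se * u = u * ρ se →
      u ∈ Algebra.adjoin ℂ (insert (ρ se) (Subalgebra.center ℂ Usl2 : Set Usl2))) ∧
    (∀ u : Usl2, ρ se * u = u * ρ se → ρ sh * u = u * ρ sh →
      u ∈ Subalgebra.center ℂ Usl2) := by
  refine ⟨fun u hu => ?_, fun u hu hh => ?_⟩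
  · obtain ⟨v, hv⟩ := HW.Ψ_surj u
    have key := HW.main u hu v hv
    rw [hv, HW.Ψ_apply]
    refine Subalgebra.sum_mem _ fun n hn => ?_
    rcases lt_or_ge n 0 with h0 | h0
    · exact absurd ((key n).1 h0) (Finsupp.mem_support_iff.1 hn)
    · obtain ⟨a, ha⟩ := (key n).2 h0
      rw [ha, HW.ev_C]
      obtain ⟨k, rfl⟩ := Int.eq_ofNat_of_zero_le h0
      refine Subalgebra.mul_mem _ (Subalgebra.pow_mem _ (Algebra.subset_adjoin
        (Set.mem_insert _ _)) k) (Algebra.subset_adjoin (Set.mem_insert_of_mem _ (HW.aeval_center a)))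
  · obtain ⟨v, hv⟩ := HW.Ψ_surj u
    have key := HW.main u hu v hv
    have key2 := HW.main2 u hh v hv
    rw [hv, HW.Ψ_apply]
    refine Subalgebra.sum_mem _ fun n hn => ?_
    have h0 : n = 0 := by
      by_contra hne
      exact Finsupp.mem_support_iff.1 hn (key2 n hne)
    subst h0
    obtain ⟨a, ha⟩ := (key 0).2 le_rfl
    have hx : HW.x 0 = 1 := pow_zero _
    rw [ha, HW.ev_C, hx, one_mul]
    exact HW.aeval_center a
end
end

section
/- The derivation D of U(sl2 ⋉ V) defined by D = 0 on sl2, D(x) = x, D(y) = y (the Euler derivation in x, y) is a well-defined derivation that commutes with the adjoint sl2-action, and it is not inner. -/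
noncomputable section

open Polynomial

/-- Free algebra on generators e, h, f, x, y. -/
abbrev F5 : Type := FreeAlgebra ℂ (Fin 5)

def ge : F5 := FreeAlgebra.ι ℂ 0
def gh : F5 := FreeAlgebra.ι ℂ 1
def gf : F5 := FreeAlgebra.ι ℂ 2
def gx : F5 := FreeAlgebra.ι ℂ 3
def gy : F5 := FreeAlgebra.ι ℂ 4

/-- The shifted Casimir element Δ = h² + 4ef − 2h (as a word in the free algebra). -/
def gΔ : F5 := gh * gh + 4 * (ge * gf) - 2 * gh

/-- Defining relations of the infinitesimal Hecke algebra H_z of sl₂: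
sl₂ relations, the standard action on V = span(x,y), and [x,y] = z. -/
inductive HRel (z : F5) : F5 → F5 → Prop
  | he : HRel z (gh * ge) (ge * gh + 2 * ge)
  | hf : HRel z (gh * gf) (gf * gh - 2 * gf)
  | ef : HRel z (ge * gf) (gf * ge + gh)
  | ex : HRel z (ge * gx) (gx * ge)
  | ey : HRel z (ge * gy) (gy * ge + gx)
  | fx : HRel z (gf * gx) (gx * gf + gy)
  | fy : HRel z (gf * gy) (gy * gf)
  | hx : HRel z (gh * gx) (gx * gh + gx)
  | hy : HRel z (gh * gy) (gy * gh - gy)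
  | xy : HRel z (gx * gy) (gy * gx + z)

/-- The infinitesimal Hecke algebra H_z (for z = 0 this is U(sl₂ ⋉ V)). -/
abbrev Hz (z : F5) : Type := RingQuot (HRel z)

/-- Canonical projection from the free algebra. -/
def π (z : F5) : F5 →ₐ[ℂ] Hz z := RingQuot.mkAlgHom ℂ (HRel z)

namespace EulerAux

abbrev MZ : Type := Matrix (Fin 4) (Fin 4) (Matrix (Fin 2) (Fin 2) ℤ)
abbrev MC : Type := Matrix (Fin 4) (Fin 4) (Matrix (Fin 2) (Fin 2) ℂ)

def sE : Matrix (Fin 2) (Fin 2) ℤ := !![0, 1; 0, 0]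
def sH : Matrix (Fin 2) (Fin 2) ℤ := !![1, 0; 0, -1]
def sF : Matrix (Fin 2) (Fin 2) ℤ := !![0, 0; 1, 0]

/-- The 8-dimensional representation `M ⊕ V ⊗ M ⊕ M` with `M` the standard representation. -/
def mE : MZ := !![sE, 0, 0, 0; 0, sE, 1, 0; 0, 0, sE, 0; 0, 0, 0, sE]
def mH : MZ := !![sH, 0, 0, 0; 0, sH + 1, 0, 0; 0, 0, sH - 1, 0; 0, 0, 0, sH]
def mF : MZ := !![sF, 0, 0, 0; 0, sF, 0, 0; 0, 1, sF, 0; 0, 0, 0, sF]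
def mX : MZ := !![0, 0, 0, 0; 1, 0, 0, 0; 0, 0, 0, 0; 0, -(sE + sE), sH, 0]
def mY : MZ := !![0, 0, 0, 0; 0, 0, 0, 0; 1, 0, 0, 0; 0, sH, sF + sF, 0]

def castM : MZ →+* MC := (Int.castRingHom ℂ).mapMatrix.mapMatrix

/-- Lifting a map of generators which satisfies the relations. -/
theorem exists_lift {A : Type} [Ring A] [Algebra ℂ A] (e h f x y : A)
    (he : h * e = e * h + 2 * e) (hf : h * f = f * h - 2 * f) (ef : e * f = f * e + h)
    (ex : e * x = x * e) (ey : e * y = y * e + x) (fx : f * x = x * f + y)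
    (fy : f * y = y * f) (hx : h * x = x * h + x) (hy : h * y = y * h - y)
    (xy : x * y = y * x) :
    ∃ φ : Hz 0 →ₐ[ℂ] A, φ (π 0 ge) = e ∧ φ (π 0 gh) = h ∧ φ (π 0 gf) = f ∧
      φ (π 0 gx) = x ∧ φ (π 0 gy) = y := by
  let g : F5 →ₐ[ℂ] A := FreeAlgebra.lift ℂ ![e, h, f, x, y]
  have g0 : g ge = e := by simp [g, ge]
  have g1 : g gh = h := by simp [g, gh]
  have g2 : g gf = f := by simp [g, gf]
  have g3 : g gx = x := by simp [g, gx]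
  have g4 : g gy = y := by simp [g, gy]
  have hg : ∀ ⦃a b : F5⦄, HRel 0 a b → g a = g b := by
    intro a b hab
    cases hab <;> simp only [map_mul, map_add, map_sub, map_zero, map_ofNat, g0, g1, g2, g3, g4,
      add_zero] <;> assumption
  refine ⟨RingQuot.liftAlgHom ℂ ⟨g, hg⟩, ?_⟩
  simp [π, g0, g1, g2, g3, g4]

theorem relπ {a b : F5} (h : HRel 0 a b) : π 0 a = π 0 b :=
  RingQuot.mkAlgHom_rel ℂ h

theorem π_surj : Function.Surjective (π 0) := RingQuot.mkAlgHom_surjective ℂ _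

/-- Induction principle for subalgebras. -/
theorem mem_of_gens (S : Subalgebra ℂ (Hz 0)) (h0 : π 0 ge ∈ S) (h1 : π 0 gh ∈ S)
    (h2 : π 0 gf ∈ S) (h3 : π 0 gx ∈ S) (h4 : π 0 gy ∈ S) (u : Hz 0) : u ∈ S := by
  obtain ⟨a, rfl⟩ := π_surj u
  induction a using FreeAlgebra.induction with
  | grade0 r => simpa using S.algebraMap_mem r
  | grade1 i => fin_cases i <;> assumption
  | mul a b ha hb => rw [map_mul]; exact S.mul_mem ha hb
  | add a b ha hb => rw [map_add]; exact S.add_mem ha hb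

section comm
variable {A : Type} [Ring A] (e h f x y : A)

def cas : A := e * (y * y) + h * (x * y) - f * (x * x)

theorem cas_comm (he : h * e = e * h + 2 * e) (hf : h * f = f * h - 2 * f) (ef : e * f = f * e + h)
    (ex : e * x = x * e) (ey : e * y = y * e + x) (fx : f * x = x * f + y)
    (fy : f * y = y * f) (hx : h * x = x * h + x) (hy : h * y = y * h - y)
    (xy : x * y = y * x) :
    Commute (cas e h f x y) e ∧ Commute (cas e h f x y) h ∧ Commute (cas e h f x y) f ∧
    Commute (cas e h f x y) x ∧ Commute (cas e h f x y) y := by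
  rw [two_mul] at he hf
  have he' : ∀ u, h * (e * u) = e * (h * u) + (e * u + e * u) := fun u => by
    rw [← mul_assoc, he]; noncomm_ring
  have hf' : ∀ u, h * (f * u) = f * (h * u) - (f * u + f * u) := fun u => by
    rw [← mul_assoc, hf]; noncomm_ring
  have ef' : ∀ u, e * (f * u) = f * (e * u) + h * u := fun u => by
    rw [← mul_assoc, ef]; noncomm_ring
  have ex' : ∀ u, e * (x * u) = x * (e * u) := fun u => by
    rw [← mul_assoc, ex]; noncomm_ring
  have ey' : ∀ u, e * (y * u) = y * (e * u) + x * u := fun u => by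
    rw [← mul_assoc, ey]; noncomm_ring
  have fx' : ∀ u, f * (x * u) = x * (f * u) + y * u := fun u => by
    rw [← mul_assoc, fx]; noncomm_ring
  have fy' : ∀ u, f * (y * u) = y * (f * u) := fun u => by
    rw [← mul_assoc, fy]; noncomm_ring
  have hx' : ∀ u, h * (x * u) = x * (h * u) + x * u := fun u => by
    rw [← mul_assoc, hx]; noncomm_ring
  have hy' : ∀ u, h * (y * u) = y * (h * u) - y * u := fun u => by
    rw [← mul_assoc, hy]; noncomm_ring
  have xy' : ∀ u, x * (y * u) = y * (x * u) := fun u => by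
    rw [← mul_assoc, xy]; noncomm_ring
  refine ⟨?_, ?_, ?_, ?_, ?_⟩ <;>
  · simp only [Commute, SemiconjBy, cas, mul_add, add_mul, mul_sub, sub_mul, mul_assoc, he, hf, ef,
      ex, ey, fx, fy, hx, hy, xy, he', hf', ef', ex', ey', fx', fy', hx', hy', xy']
    abel

end comm

theorem cas_ne : cas (π 0 ge) (π 0 gh) (π 0 gf) (π 0 gx) (π 0 gy) ≠ 0 := by
  intro h0
  have key : ∀ {a b : MZ}, a = b → castM a = castM b := fun h => by rw [h]
  obtain ⟨φ, h1, h2, h3, h4, h5⟩ := exists_lift (castM mE) (castM mH) (castM mF) (castM mX)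
    (castM mY)
    (by simpa only [map_mul, map_add, map_sub, map_ofNat] using
      key (show mH * mE = mE * mH + 2 * mE by decide +kernel))
    (by simpa only [map_mul, map_add, map_sub, map_ofNat] using
      key (show mH * mF = mF * mH - 2 * mF by decide +kernel))
    (by simpa only [map_mul, map_add] using
      key (show mE * mF = mF * mE + mH by decide +kernel))
    (by simpa only [map_mul, map_add] using
      key (show mE * mX = mX * mE by decide +kernel))
    (by simpa only [map_mul, map_add] using
      key (show mE * mY = mY * mE + mX by decide +kernel))
    (by simpa only [map_mul, map_add] using
      key (show mF * mX = mX * mF + mY by decide +kernel))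
    (by simpa only [map_mul, map_add] using
      key (show mF * mY = mY * mF by decide +kernel))
    (by simpa only [map_mul, map_add] using
      key (show mH * mX = mX * mH + mX by decide +kernel))
    (by simpa only [map_mul, map_add, map_sub] using
      key (show mH * mY = mY * mH - mY by decide +kernel))
    (by simpa only [map_mul, map_add] using
      key (show mX * mY = mY * mX by decide +kernel))
  have h := congrArg φ h0
  simp only [cas, map_add, map_sub, map_mul, map_zero, h1, h2, h3, h4, h5] at h
  simp only [← map_add, ← map_sub, ← map_mul] at h
  have h' := congrFun (congrFun (congrFun (congrFun h 3) 0) 0) 0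
  have e3 : (mE * (mY * mY) + mH * (mX * mY) - mF * (mX * mX)) 3 0 0 0 = 3 := by decide +kernel
  have : ((( mE * (mY * mY) + mH * (mX * mY) - mF * (mX * mX)) 3 0 0 0 : ℤ) : ℂ) = 0 := h'
  rw [e3] at this
  norm_num at this

theorem exists_D : ∃ D : Hz 0 →ₗ[ℂ] Hz 0,
      (∀ a b : Hz 0, D (a * b) = D a * b + a * D b) ∧
      D (π 0 ge) = 0 ∧ D (π 0 gh) = 0 ∧ D (π 0 gf) = 0 ∧
      D (π 0 gx) = π 0 gx ∧ D (π 0 gy) = π 0 gy := by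
  let i : Hz 0 → Matrix (Fin 2) (Fin 2) (Hz 0) := fun a => !![a, 0; 0, a]
  let j : Hz 0 → Matrix (Fin 2) (Fin 2) (Hz 0) := fun a => !![a, a; 0, a]
  have two : (2 : Matrix (Fin 2) (Fin 2) (Hz 0)) = !![2, 0; 0, 2] := by
    ext a b; fin_cases a <;> fin_cases b <;> simp [Matrix.ofNat_apply]
  have he := relπ HRel.he
  have hf := relπ HRel.hf
  have ef := relπ HRel.ef
  have ex := relπ HRel.ex
  have ey := relπ HRel.ey
  have fx := relπ HRel.fx
  have fy := relπ HRel.fy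
  have hx := relπ HRel.hx
  have hy := relπ HRel.hy
  have xy := relπ HRel.xy
  simp only [map_mul, map_add, map_sub, map_ofNat, map_zero, add_zero] at he hf ef ex ey fx fy hx hy xy
  obtain ⟨φ, h1, h2, h3, h4, h5⟩ := exists_lift (i (π 0 ge)) (i (π 0 gh)) (i (π 0 gf))
    (j (π 0 gx)) (j (π 0 gy))
    (by simp [i, two, he]) (by simp [i, two, hf]) (by simp [i, ef])
    (by simp [i, j, ex]) (by simp [i, j, ey]) (by simp [i, j, fx])
    (by simp [i, j, fy]) (by simp [i, j, hx]) (by simp [i, j, hy]) (by simp [j, xy])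
  have hφ : ∀ u : Hz 0, φ u 0 0 = u ∧ φ u 1 0 = 0 ∧ φ u 1 1 = u := by
    let S : Subalgebra ℂ (Hz 0) :=
      { carrier := {u | φ u 0 0 = u ∧ φ u 1 0 = 0 ∧ φ u 1 1 = u}
        mul_mem' := by
          rintro a b ⟨ha, ha', ha2⟩ ⟨hb, hb', hb2⟩
          simp [Matrix.mul_apply, Fin.sum_univ_two, ha, ha', hb, hb', ha2, hb2]
        add_mem' := by
          rintro a b ⟨ha, ha', ha2⟩ ⟨hb, hb', hb2⟩
          simp [ha, ha', hb, hb', ha2, hb2]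
        algebraMap_mem' := by
          intro r
          simp [Matrix.algebraMap_matrix_apply] }
    exact mem_of_gens S (by simp [S, h1, i]) (by simp [S, h2, i]) (by simp [S, h3, i])
      (by simp [S, h4, j]) (by simp [S, h5, j])
  refine ⟨{ toFun := fun u => φ u 0 1, map_add' := ?_, map_smul' := ?_ }, ?_, ?_, ?_, ?_, ?_, ?_⟩
  · intro a b; simp
  · intro r a; simp
  · intro a b
    simp [Matrix.mul_apply, Fin.sum_univ_two, hφ, add_comm]
  · simp [h1, i]
  · simp [h2, i]
  · simp [h3, i]
  · simp [h4, j]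
  · simp [h5, j]

end EulerAux

/-- The Euler derivation of U(sl₂ ⋉ V): vanishing on sl₂, sending x ↦ x, y ↦ y.
It is a well-defined derivation, commutes with the adjoint sl₂-action, and is not inner. -/
theorem euler_derivation_exists_not_inner :
    ∃ D : Hz 0 →ₗ[ℂ] Hz 0,
      (∀ a b : Hz 0, D (a * b) = D a * b + a * D b) ∧
      D (π 0 ge) = 0 ∧ D (π 0 gh) = 0 ∧ D (π 0 gf) = 0 ∧
      D (π 0 gx) = π 0 gx ∧ D (π 0 gy) = π 0 gy ∧
      (∀ g ∈ ({π 0 ge, π 0 gh, π 0 gf} : Set (Hz 0)), ∀ u : Hz 0,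
        D (g * u - u * g) = g * D u - D u * g) ∧
      ¬ ∃ w : Hz 0, ∀ a : Hz 0, D a = w * a - a * w := by
  obtain ⟨D, hD, d0, d1, d2, d3, d4⟩ := EulerAux.exists_D
  refine ⟨D, hD, d0, d1, d2, d3, d4, ?_, ?_⟩
  · rintro g hg u
    have hg0 : D g = 0 := by
      rcases hg with rfl | rfl | rfl <;> assumption
    rw [map_sub, hD, hD, hg0]; simp
  · rintro ⟨w, hw⟩
    have he := EulerAux.relπ HRel.he
    have hf := EulerAux.relπ HRel.hf
    have ef := EulerAux.relπ HRel.ef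
    have ex := EulerAux.relπ HRel.ex
    have ey := EulerAux.relπ HRel.ey
    have fx := EulerAux.relπ HRel.fx
    have fy := EulerAux.relπ HRel.fy
    have hx := EulerAux.relπ HRel.hx
    have hy := EulerAux.relπ HRel.hy
    have xy := EulerAux.relπ HRel.xy
    simp only [map_mul, map_add, map_sub, map_ofNat, map_zero, add_zero] at he hf ef ex ey fx fy hx hy xy
    obtain ⟨c0, c1, c2, c3, c4⟩ := EulerAux.cas_comm _ _ _ _ _ he hf ef ex ey fx fy hx hy xy
    set C := EulerAux.cas (π 0 ge) (π 0 gh) (π 0 gf) (π 0 gx) (π 0 gy) with hC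
    have hc := EulerAux.mem_of_gens (Subalgebra.centralizer ℂ {C})
      (by simpa [Subalgebra.mem_centralizer_iff] using c0.eq)
      (by simpa [Subalgebra.mem_centralizer_iff] using c1.eq)
      (by simpa [Subalgebra.mem_centralizer_iff] using c2.eq)
      (by simpa [Subalgebra.mem_centralizer_iff] using c3.eq)
      (by simpa [Subalgebra.mem_centralizer_iff] using c4.eq) w
    have hcw : C * w = w * C := by simpa [Subalgebra.mem_centralizer_iff] using hc
    have h0 : D C = 0 := by rw [hw, hcw, sub_self]
    have h2 : D C = (2 : ℂ) • C := by
      rw [two_smul, hC]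
      simp only [EulerAux.cas, map_add, map_sub, hD, d0, d1, d2, d3, d4]
      noncomm_ring
    rw [h2] at h0
    exact EulerAux.cas_ne ((smul_eq_zero_iff_right two_ne_zero).mp h0)
end
end
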